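/- Let p be a prime, let P ∈ ℚ_p[X₁,…,Xₙ], let s, v ∈ ℤ, and let z ∈ ℤ_p^n satisfy p^{s−1} < J_P(z) ≤ p^{s} and p^{v−1} < H_P(z) ≤ p^{v}. Then for every t ∈ ℤ_p^n with max_i |t_i − z_i| ≤ p^{-s}, one has J_P(t) = J_P(z) and H_P(t) = H_P(z). -/

import Mathlib

/-- The iterated partial derivative `∂^β P` of a polynomial in `n` variables. -/
noncomputable def mvDeriv {p : ℕ} [Fact p.Prime] {n : ℕ} (β : Fin n → ℕ)
    (P : MvPolynomial (Fin n) ℚ_[p]) : MvPolynomial (Fin n) ℚ_[p] :=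
  (List.finRange n).foldl (fun Q i => (⇑(MvPolynomial.pderiv i))^[β i] Q) P

/-- `H_P(z) = max_{1 ≤ |β| ≤ deg P} |∂^β P(z)/β!|^{1/|β|}` (empty max = 0). -/
noncomputable def HfunMv {p : ℕ} [Fact p.Prime] {n : ℕ} (P : MvPolynomial (Fin n) ℚ_[p])
    (z : Fin n → ℤ_[p]) : NNReal :=
  Finset.univ.sup fun b : Fin n → Fin (P.totalDegree + 1) =>
    if 1 ≤ ∑ i, (b i : ℕ) ∧ ∑ i, (b i : ℕ) ≤ P.totalDegree then
      ‖MvPolynomial.eval (fun i => ((z i : ℚ_[p])))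
          (mvDeriv (fun i => (b i : ℕ)) P) /
          ((∏ i, Nat.factorial (b i) : ℕ) : ℚ_[p])‖₊ ^ ((1 : ℝ) / ((∑ i, (b i : ℕ) : ℕ) : ℝ))
    else 0

/-- `J_P(z) = max_{2 ≤ |β| ≤ deg P} |∂^β P(z)/β!|^{1/|β|}` (empty max = 0). -/
noncomputable def JfunMv {p : ℕ} [Fact p.Prime] {n : ℕ} (P : MvPolynomial (Fin n) ℚ_[p])
    (z : Fin n → ℤ_[p]) : NNReal :=
  Finset.univ.sup fun b : Fin n → Fin (P.totalDegree + 1) =>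
    if 2 ≤ ∑ i, (b i : ℕ) ∧ ∑ i, (b i : ℕ) ≤ P.totalDegree then
      ‖MvPolynomial.eval (fun i => ((z i : ℚ_[p])))
          (mvDeriv (fun i => (b i : ℕ)) P) /
          ((∏ i, Nat.factorial (b i) : ℕ) : ℚ_[p])‖₊ ^ ((1 : ℝ) / ((∑ i, (b i : ℕ) : ℕ) : ℝ))
    else 0

/-- `H_P = inf_{z ∈ ℤ_p^n} H_P(z)`. -/
noncomputable def HinfMv {p : ℕ} [Fact p.Prime] {n : ℕ} (P : MvPolynomial (Fin n) ℚ_[p]) :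
    NNReal :=
  ⨅ z : Fin n → ℤ_[p], HfunMv P z

/-- The polynomial `p^{-α} Q` regarded as an element of `ℚ_p[X₁,…,Xₙ]`. -/
noncomputable def mvScaled (p : ℕ) [Fact p.Prime] {n : ℕ} (α : ℕ)
    (Q : MvPolynomial (Fin n) ℤ) : MvPolynomial (Fin n) ℚ_[p] :=
  MvPolynomial.C (((p : ℚ_[p]) ^ α)⁻¹) * MvPolynomial.map (Int.castRingHom ℚ_[p]) Q

section Pderiv

variable {σ K : Type*} [CommRing K]

theorem iterate_pderiv_monomial (i : σ) (k : ℕ) (m : σ →₀ ℕ) (a : K) :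
    (⇑(MvPolynomial.pderiv i))^[k] (MvPolynomial.monomial m a) =
      MvPolynomial.monomial (m - Finsupp.single i k) (a * (m i).descFactorial k) := by
  classical
  induction k with
  | zero => simp
  | succ k ih =>
    rw [Function.iterate_succ_apply', ih, MvPolynomial.pderiv_monomial, tsub_tsub,
      ← Finsupp.single_add, Nat.descFactorial_succ]
    congr 1
    simp
    ring

theorem iterate_pderiv_sum {ι : Type*} (s : Finset ι) (f : ι → MvPolynomial σ K) (i : σ) (k : ℕ) :
    (⇑(MvPolynomial.pderiv i))^[k] (∑ j ∈ s, f j) =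
      ∑ j ∈ s, (⇑(MvPolynomial.pderiv i))^[k] (f j) := by
  induction k with
  | zero => rfl
  | succ k ih => simp only [Function.iterate_succ_apply', ih, map_sum]

theorem foldl_pderiv_sum {ι : Type*} (s : Finset ι) (b : σ → ℕ) (l : List σ)
    (f : ι → MvPolynomial σ K) :
    l.foldl (fun Q i => (⇑(MvPolynomial.pderiv i))^[b i] Q) (∑ j ∈ s, f j) =
      ∑ j ∈ s, l.foldl (fun Q i => (⇑(MvPolynomial.pderiv i))^[b i] Q) (f j) := by
  induction l generalizing f with
  | nil => rfl
  | cons i l ih => simp only [List.foldl_cons, iterate_pderiv_sum, ih]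

theorem foldl_pderiv_monomial (b : σ → ℕ) (l : List σ) (hl : l.Nodup) (m : σ →₀ ℕ) (a : K) :
    l.foldl (fun Q i => (⇑(MvPolynomial.pderiv i))^[b i] Q) (MvPolynomial.monomial m a) =
      MvPolynomial.monomial (m - (l.map fun i => Finsupp.single i (b i)).sum)
        (a * (l.map fun i => ((m i).descFactorial (b i) : K)).prod) := by
  classical
  induction l generalizing m a with
  | nil => simp
  | cons i l ih =>
    rw [List.nodup_cons] at hl
    have hmap : (l.map fun j => (((m - Finsupp.single i (b i)) j).descFactorial (b j) : K)) =
        l.map fun j => ((m j).descFactorial (b j) : K) := by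
      refine List.map_congr_left fun j hj => ?_
      have : i ≠ j := fun h => hl.1 (h ▸ hj)
      simp [Finsupp.single_eq_of_ne' this]
    rw [List.foldl_cons, iterate_pderiv_monomial, ih hl.2, hmap, tsub_tsub, List.map_cons,
      List.sum_cons, List.map_cons, List.prod_cons, mul_assoc]

end Pderiv

section Hasse

variable {σ K : Type*} [Fintype σ] [CommRing K]

/-- The value at `z` of the Hasse derivative `∂^b P / b!`. -/
def hasseCoeff (P : MvPolynomial σ K) (b : σ → ℕ) (z : σ → K) : K :=
  ∑ m ∈ P.support, P.coeff m * ∏ i, ((m i).choose (b i) * z i ^ (m i - b i))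

theorem choose_mul_add_pow_sub (m b N : ℕ) (hN : m < N) (z h : K) :
    (m.choose b : K) * (z + h) ^ (m - b) =
      ∑ g ∈ Finset.range N, ((g.choose b : K) * h ^ (g - b)) * (m.choose g * z ^ (m - g)) := by
  rcases lt_or_ge m b with hmb | hmb
  · rw [Nat.choose_eq_zero_of_lt hmb, Nat.cast_zero, zero_mul, Finset.sum_eq_zero]
    intro g _
    rcases lt_or_ge g b with hg | hg
    · simp [Nat.choose_eq_zero_of_lt hg]
    · simp [Nat.choose_eq_zero_of_lt (hmb.trans_le hg)]
  · have hsub : Finset.image (fun k => b + k) (Finset.range (m - b + 1)) ⊆ Finset.range N := by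
      intro g hg
      simp only [Finset.mem_image, Finset.mem_range] at hg ⊢
      omega
    rw [← Finset.sum_subset hsub, Finset.sum_image (by intro x _ y _ h; simpa using h),
      add_comm z h, add_pow, Finset.mul_sum]
    · refine Finset.sum_congr rfl fun k hk => ?_
      rw [Finset.mem_range] at hk
      have key := Nat.choose_mul (n := m) (k := b + k) (s := b) (by omega)
      rw [Nat.add_sub_cancel_left] at key
      have key' : (m.choose (b + k) : K) * ((b + k).choose b) = m.choose b * (m - b).choose k := by
        simpa only [Nat.cast_mul] using congrArg (Nat.cast : ℕ → K) key
      rw [Nat.add_sub_cancel_left, ← Nat.sub_sub]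
      linear_combination (-(h ^ k * z ^ (m - b - k))) * key'
    · intro g _ hg
      simp only [Finset.mem_image, Finset.mem_range, not_exists, not_and] at hg
      rcases lt_or_ge g b with hgb | hgb
      · simp [Nat.choose_eq_zero_of_lt hgb]
      · have : m < g := by
          by_contra hc
          exact hg (g - b) (by omega) (by omega)
        simp [Nat.choose_eq_zero_of_lt this]

theorem hasseCoeff_add [DecidableEq σ] (P : MvPolynomial σ K) (b : σ → ℕ) (z h : σ → K) :
    hasseCoeff P b (z + h) =
      ∑ g ∈ Fintype.piFinset fun _ => Finset.range (P.totalDegree + 1),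
        (∏ i, (((g i).choose (b i) : K) * h i ^ (g i - b i))) * hasseCoeff P g z := by
  simp only [hasseCoeff, Finset.mul_sum]
  rw [Finset.sum_comm]
  refine Finset.sum_congr rfl fun m hm => ?_
  have hm' : ∀ i, m i < P.totalDegree + 1 := fun i => by
    have h1 := MvPolynomial.le_totalDegree hm
    have h2 : m i ≤ m.sum fun _ e => e := by
      rw [Finsupp.sum_fintype _ _ (by simp)]
      exact Finset.single_le_sum (f := fun i => m i) (by simp) (Finset.mem_univ i)
    omega
  simp only [Pi.add_apply]
  rw [Finset.prod_congr rfl fun i _ =>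
    choose_mul_add_pow_sub (m i) (b i) (P.totalDegree + 1) (hm' i) (z i) (h i),
    Finset.prod_univ_sum, Finset.mul_sum]
  refine Finset.sum_congr rfl fun g _ => ?_
  rw [Finset.prod_mul_distrib]
  ring

theorem hasseCoeff_eq_zero_of_totalDegree_lt (P : MvPolynomial σ K) (b : σ → ℕ) (z : σ → K)
    (hb : P.totalDegree < ∑ i, b i) : hasseCoeff P b z = 0 := by
  refine Finset.sum_eq_zero fun m hm => ?_
  have h1 := MvPolynomial.le_totalDegree hm
  rw [Finsupp.sum_fintype _ _ (by simp)] at h1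
  obtain ⟨i, -, hi⟩ := Finset.exists_lt_of_sum_lt (h1.trans_lt hb)
  rw [Finset.prod_eq_zero (Finset.mem_univ i) (by simp [Nat.choose_eq_zero_of_lt hi]), mul_zero]

end Hasse

section Padic

variable {p : ℕ} [Fact p.Prime] {n : ℕ}

theorem eval_mvDeriv (b : Fin n → ℕ) (P : MvPolynomial (Fin n) ℚ_[p]) (z : Fin n → ℚ_[p]) :
    MvPolynomial.eval z (mvDeriv b P) =
      ((∏ i, (b i).factorial : ℕ) : ℚ_[p]) * hasseCoeff P b z := by
  conv_lhs => rw [P.as_sum]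
  rw [mvDeriv, foldl_pderiv_sum, map_sum, hasseCoeff, Finset.mul_sum]
  refine Finset.sum_congr rfl fun m _ => ?_
  have hsum : ((List.finRange n).map fun i => Finsupp.single i (b i)).sum =
      Finsupp.equivFunOnFinite.symm b := by
    rw [← List.ofFn_eq_map, List.sum_ofFn]
    ext j
    simp [Finsupp.finsetSum_apply, Finsupp.single_apply]
  rw [foldl_pderiv_monomial _ _ (List.nodup_finRange n), hsum, ← List.ofFn_eq_map,
    List.prod_ofFn, MvPolynomial.eval_monomial, Finsupp.prod_fintype _ _ (by simp)]
  simp only [Nat.descFactorial_eq_factorial_mul_choose, Finset.prod_mul_distrib, Nat.cast_mul,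
    Nat.cast_prod, Finsupp.coe_tsub, Pi.sub_apply, Finsupp.equivFunOnFinite_symm_apply_apply]
  ring

theorem eval_mvDeriv_div (b : Fin n → ℕ) (P : MvPolynomial (Fin n) ℚ_[p]) (z : Fin n → ℚ_[p]) :
    MvPolynomial.eval z (mvDeriv b P) / ((∏ i, (b i).factorial : ℕ) : ℚ_[p]) =
      hasseCoeff P b z := by
  rw [eval_mvDeriv, mul_div_cancel_left₀]
  exact_mod_cast Finset.prod_ne_zero_iff.mpr fun i _ => Nat.factorial_ne_zero _

/-- The common generalization of `HfunMv` (`d = 1`) and `JfunMv` (`d = 2`): the maximum over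
`d ≤ |β| ≤ deg P`. -/
noncomputable def maxHasse (d : ℕ) (P : MvPolynomial (Fin n) ℚ_[p]) (z : Fin n → ℤ_[p]) : NNReal :=
  Finset.univ.sup fun b : Fin n → Fin (P.totalDegree + 1) =>
    if d ≤ ∑ i, (b i : ℕ) ∧ ∑ i, (b i : ℕ) ≤ P.totalDegree then
      ‖MvPolynomial.eval (fun i => ((z i : ℚ_[p])))
          (mvDeriv (fun i => (b i : ℕ)) P) /
          ((∏ i, Nat.factorial (b i) : ℕ) : ℚ_[p])‖₊ ^ ((1 : ℝ) / ((∑ i, (b i : ℕ) : ℕ) : ℝ))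
    else 0

theorem maxHasse_le_iff {d : ℕ} (hd : 1 ≤ d) (P : MvPolynomial (Fin n) ℚ_[p])
    (z : Fin n → ℤ_[p]) (M : NNReal) :
    maxHasse d P z ≤ M ↔ ∀ b : Fin n → ℕ, d ≤ ∑ i, b i →
      ‖hasseCoeff P b fun i => (z i : ℚ_[p])‖ ≤ (M : ℝ) ^ ∑ i, b i := by
  have aux : ∀ b : Fin n → ℕ, d ≤ ∑ i, b i →
      (‖hasseCoeff P b fun i => (z i : ℚ_[p])‖₊ ^ ((1 : ℝ) / ((∑ i, b i : ℕ) : ℝ)) ≤ M ↔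
        ‖hasseCoeff P b fun i => (z i : ℚ_[p])‖ ≤ (M : ℝ) ^ ∑ i, b i) := by
    intro b hb
    have hpos : (0 : ℝ) < ((∑ i, b i : ℕ) : ℝ) := by exact_mod_cast hd.trans hb
    rw [one_div, NNReal.rpow_inv_le_iff hpos, NNReal.rpow_natCast, ← NNReal.coe_le_coe,
      coe_nnnorm, NNReal.coe_pow]
  rw [maxHasse, Finset.sup_le_iff]
  constructor
  · intro h b hb
    rcases lt_or_ge P.totalDegree (∑ i, b i) with hlt | hle
    · rw [hasseCoeff_eq_zero_of_totalDegree_lt _ _ _ hlt, norm_zero]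
      positivity
    · have hbi : ∀ i, b i < P.totalDegree + 1 := fun i =>
        Nat.lt_succ_of_le
          ((Finset.single_le_sum (f := b) (by simp) (Finset.mem_univ i)).trans hle)
      have := h (fun i => ⟨b i, hbi i⟩) (Finset.mem_univ _)
      rw [if_pos ⟨hb, hle⟩, eval_mvDeriv_div] at this
      exact (aux b hb).mp this
  · intro h b _
    split_ifs with hb
    · rw [eval_mvDeriv_div]
      exact (aux _ hb.1).mpr (h _ hb.1)
    · exact zero_le

theorem norm_hasseCoeff_add_le (P : MvPolynomial (Fin n) ℚ_[p]) (b : Fin n → ℕ)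
    (z h : Fin n → ℚ_[p]) (R B : ℝ) (hR : ∀ i, ‖h i‖ ≤ R) (hB : 0 ≤ B)
    (hz : ∀ g : Fin n → ℕ, b ≤ g → R ^ (∑ i, g i - ∑ i, b i) * ‖hasseCoeff P g z‖ ≤ B) :
    ‖hasseCoeff P b (z + h)‖ ≤ B := by
  rw [hasseCoeff_add]
  refine IsUltrametricDist.norm_sum_le_of_forall_le_of_nonneg hB fun g _ => ?_
  by_cases hg : b ≤ g
  · refine le_trans ?_ (hz g hg)
    rw [norm_mul, norm_prod]
    refine mul_le_mul_of_nonneg_right ?_ (norm_nonneg _)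
    rw [← Finset.sum_tsub_distrib _ fun i _ => hg i, ← Finset.prod_pow_eq_pow_sum]
    refine Finset.prod_le_prod (fun i _ => norm_nonneg _) fun i _ => ?_
    rw [norm_mul, norm_pow]
    have h1 : ‖((g i).choose (b i) : ℚ_[p])‖ ≤ 1 := by
      exact_mod_cast Padic.norm_int_le_one ((g i).choose (b i) : ℤ)
    calc _ ≤ 1 * ‖h i‖ ^ (g i - b i) := by gcongr
      _ ≤ R ^ (g i - b i) := by
        rw [one_mul]
        exact pow_le_pow_left₀ (norm_nonneg _) (hR i) _
  · obtain ⟨i, hi⟩ := not_forall.mp hg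
    rw [Finset.prod_eq_zero (Finset.mem_univ i)
      (by simp [Nat.choose_eq_zero_of_lt (not_le.mp hi)]), zero_mul, norm_zero]
    exact hB

theorem maxHasse_mono {d e : ℕ} (hd : 1 ≤ d) (hde : d ≤ e) (P : MvPolynomial (Fin n) ℚ_[p])
    (z : Fin n → ℤ_[p]) : maxHasse e P z ≤ maxHasse d P z :=
  (maxHasse_le_iff (hd.trans hde) P z _).mpr fun b hb =>
    (maxHasse_le_iff hd P z _).mp le_rfl b (hde.trans hb)

/-- On a ball of radius `R` with `R * maxHasse (d + 1) P z ≤ 1`, the value of `maxHasse d P` does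
not exceed its value at the centre `z`. -/
theorem maxHasse_le_of_dist_le {d : ℕ} (hd : 1 ≤ d) (P : MvPolynomial (Fin n) ℚ_[p])
    (z t : Fin n → ℤ_[p]) (R : ℝ) (hR : 0 ≤ R) (ht : ∀ i, ‖t i - z i‖ ≤ R)
    (hz : R * maxHasse (d + 1) P z ≤ 1) : maxHasse d P t ≤ maxHasse d P z := by
  rw [maxHasse_le_iff hd]
  intro b hb
  have hadd : (fun i => (t i : ℚ_[p])) =
      (fun i => (z i : ℚ_[p])) + fun i => ((t i - z i : ℤ_[p]) : ℚ_[p]) := by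
    ext i
    simp
  have hJ := (maxHasse_le_iff (Nat.le_add_left 1 d) P z _).mp le_rfl
  have hH := (maxHasse_le_iff hd P z _).mp le_rfl
  have hJH : (maxHasse (d + 1) P z : ℝ) ≤ maxHasse d P z :=
    maxHasse_mono hd (Nat.le_succ d) P z
  rw [hadd]
  refine norm_hasseCoeff_add_le P b _ _ R _ ht (by positivity) fun g hbg => ?_
  have hle : ∑ i, b i ≤ ∑ i, g i := Finset.sum_le_sum fun i _ => hbg i
  rcases hle.eq_or_lt with heq | hlt
  · rw [heq, Nat.sub_self, pow_zero, one_mul]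
    exact hH g (hb.trans hle)
  · obtain ⟨k, hk⟩ := Nat.exists_eq_add_of_le hle
    calc R ^ (∑ i, g i - ∑ i, b i) * ‖hasseCoeff P g fun i => (z i : ℚ_[p])‖
        ≤ R ^ (∑ i, g i - ∑ i, b i) * (maxHasse (d + 1) P z : ℝ) ^ ∑ i, g i := by
          gcongr
          exact hJ g (by omega)
      _ = (R * maxHasse (d + 1) P z) ^ k * (maxHasse (d + 1) P z : ℝ) ^ ∑ i, b i := by
          rw [hk, Nat.add_sub_cancel_left, pow_add, mul_pow]
          ring
      _ ≤ 1 * (maxHasse d P z : ℝ) ^ ∑ i, b i := by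
          gcongr
          exact pow_le_one₀ (by positivity) hz
      _ = _ := one_mul _

end Padic

/-- Lemma 10.1: if `p^{s-1} < J_P(z) ≤ p^s` and `p^{v-1} < H_P(z) ≤ p^v`, then `J_P` and
`H_P` are constant on the ball `{t : max_i |t_i - z_i| ≤ p^{-s}}` around `z`. -/
theorem HJ_locally_constant (p : ℕ) [Fact p.Prime] (n : ℕ)
    (P : MvPolynomial (Fin n) ℚ_[p]) (s v : ℤ) (z : Fin n → ℤ_[p])
    (hJ1 : (p : ℝ) ^ (s - 1) < (JfunMv P z : ℝ)) (hJ2 : (JfunMv P z : ℝ) ≤ (p : ℝ) ^ s)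
    (hH1 : (p : ℝ) ^ (v - 1) < (HfunMv P z : ℝ)) (hH2 : (HfunMv P z : ℝ) ≤ (p : ℝ) ^ v) :
    ∀ t : Fin n → ℤ_[p], (∀ i, ‖t i - z i‖ ≤ (p : ℝ) ^ (-s)) →
      JfunMv P t = JfunMv P z ∧ HfunMv P t = HfunMv P z := by
  have hp : (0 : ℝ) < p := by exact_mod_cast (Fact.out : p.Prime).pos
  intro t ht
  have hR : (0 : ℝ) ≤ (p : ℝ) ^ (-s) := by positivity
  have scaled : ∀ x : NNReal, (x : ℝ) ≤ (p : ℝ) ^ s → (p : ℝ) ^ (-s) * x ≤ 1 := fun x hx => by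
    calc (p : ℝ) ^ (-s) * x ≤ (p : ℝ) ^ (-s) * (p : ℝ) ^ s := by gcongr
      _ = 1 := by rw [← zpow_add₀ hp.ne', neg_add_cancel, zpow_zero]
  have ht' : ∀ i, ‖z i - t i‖ ≤ (p : ℝ) ^ (-s) := fun i => norm_sub_rev (z i) (t i) ▸ ht i
  change (maxHasse 2 P z : ℝ) ≤ _ at hJ2
  change maxHasse 2 P t = maxHasse 2 P z ∧ maxHasse 1 P t = maxHasse 1 P z
  have step : ∀ x : Fin n → ℤ_[p], (maxHasse 2 P x : ℝ) ≤ (p : ℝ) ^ s →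
      (p : ℝ) ^ (-s) * maxHasse 3 P x ≤ 1 := fun x hx =>
    scaled _ (le_trans (maxHasse_mono one_le_two (Nat.le_succ 2) P x) hx)
  have hJt := maxHasse_le_of_dist_le one_le_two P z t _ hR ht (step z hJ2)
  have hJt2 : (maxHasse 2 P t : ℝ) ≤ (p : ℝ) ^ s := le_trans hJt hJ2
  exact ⟨hJt.antisymm (maxHasse_le_of_dist_le one_le_two P t z _ hR ht' (step t hJt2)),
    (maxHasse_le_of_dist_le le_rfl P z t _ hR ht (scaled _ hJ2)).antisymm
      (maxHasse_le_of_dist_le le_rfl P t z _ hR ht' (scaled _ hJt2))⟩
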